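/- Let i ≥ −1, n ≥ 1 and 0 ≤ r ≤ n+i. Then φ_{i,n}^r, the map C ↦ Ĉ(r), is a bijection from {C ∈ C_i(n) : for all j ∈ [r], the j-set of C is not a plus-full-set} to F_i^{r+1}(n+1). -/

import Mathlib

/-!
Common definitions for formalizing "A recursion on maximal chains in the Tamari lattices"
(L. Nelson).

* Young diagrams are encoded by their row-length functions `lam : ℕ → ℕ` (rows indexed from 1,
  with `lam 0 = 0`).
* Dyck paths are lists of steps (north/east).
* Tableaux are encoded by entry functions `f : ℕ × ℕ → ℕ` (1-indexed boxes; value `0` means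
  "no box").  The label of box `(x, y)` is `f (x, y)`.
-/

noncomputable section

namespace TamariMaxChains

/-- A step of a lattice path: north or east. -/
inductive Step : Type
  | N : Step
  | E : Step
deriving DecidableEq

/-- Number of north steps of a path. -/
def nCount (p : List Step) : ℕ := p.count Step.N

/-- Number of east steps of a path. -/
def eCount (p : List Step) : ℕ := p.count Step.E

/-- `p` is a Dyck path: equally many norths and easts, and every prefix has at least as many
north steps as east steps (the path never goes below the diagonal `y = x`). -/
def IsDyck (p : List Step) : Prop :=
  nCount p = eCount p ∧ ∀ q : List Step, q <+: p → eCount q ≤ nCount q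

/-- `q` is a prime Dyck path: it meets the slope-one line joining its endpoints only at its
endpoints. -/
def IsPrimeDyck (q : List Step) : Prop :=
  q ≠ [] ∧ nCount q = eCount q ∧
    ∀ s : List Step, s <+: q → s ≠ [] → s ≠ q → eCount s < nCount s

/-- Covering relation of the Tamari lattice on Dyck paths:  `TamariCoverD P' P` means `P'`
covers `P`, i.e. `P'` is obtained from `P` by swapping an east step that is followed by a north
step with the prime Dyck subpath following it. -/
def TamariCoverD (P' P : List Step) : Prop :=
  ∃ a q b : List Step, IsPrimeDyck q ∧
    P = a ++ Step.E :: (q ++ b) ∧ P' = a ++ (q ++ Step.E :: b)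

/-- `lam` is the row-length function of a Young diagram: rows are indexed from `1`,
`lam x` is the number of boxes in row `x`, rows weakly decrease, finitely many boxes. -/
def IsDiagram (lam : ℕ → ℕ) : Prop :=
  lam 0 = 0 ∧ (∀ x, 1 ≤ x → lam (x + 1) ≤ lam x) ∧ ∃ N, ∀ x, N ≤ x → lam x = 0

/-- The height (number of north steps) of the prime path of row `d ≥ 1` of the Young diagram
with row lengths `lam`:  the least `t ≥ 1` such that either `t = d` (row `0` being regarded as
an infinite row of boxes) or row `d - t` has length at least `lam d + t`. -/
def primeHeight (lam : ℕ → ℕ) (d : ℕ) : ℕ :=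
  sInf {t | 1 ≤ t ∧ (t = d ∨ (t < d ∧ lam d + t ≤ lam (d - t)))}

/-- The last box of row `d` is a corner box (last box of its row and lowest box of
its column). -/
def IsCorner (lam : ℕ → ℕ) (d : ℕ) : Prop := 1 ≤ d ∧ 1 ≤ lam d ∧ lam (d + 1) < lam d

/-- The result of removing the `B`-strip of the last box `B` of row `d`: the last box of each of
the rows `d - h + 1, …, d` is removed, where `h` is the height of the prime path of row `d`. -/
def removeStrip (lam : ℕ → ℕ) (d : ℕ) : ℕ → ℕ := fun x =>
  if d + 1 ≤ x + primeHeight lam d ∧ x ≤ d then lam x - 1 else lam x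

/-- Covering relation of the Tamari lattice on Young diagrams:  `mu` covers `lam` iff `mu` is
obtained from `lam` by removing the `B`-strip of a corner box `B`. -/
def TamariCoverY (mu lam : ℕ → ℕ) : Prop := ∃ d, IsCorner lam d ∧ mu = removeStrip lam d

/-- The `B`-strip of the last box `B` of row `d`: the set of last boxes of rows
`d - h + 1, …, d`, where `h` is the height of the prime path of row `d`. -/
def stripSet (lam : ℕ → ℕ) (d : ℕ) : Set (ℕ × ℕ) :=
  {b | b.2 = lam b.1 ∧ 1 ≤ b.2 ∧ d + 1 ≤ b.1 + primeHeight lam d ∧ b.1 ≤ d}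

/-- The enclosure of the `B`-strip of the last box `B = (d, lam d)` of row `d`: all boxes
`(x, y)` with `d - h ≤ x ≤ d` and `lam d ≤ y ≤ lam d + h`, where row `0` is regarded as an
infinite row of boxes. -/
def enclosure (lam : ℕ → ℕ) (d : ℕ) : Set (ℕ × ℕ) :=
  {b | (b.1 = 0 ∨ b.2 ≤ lam b.1) ∧ 1 ≤ b.2 ∧
    d ≤ b.1 + primeHeight lam d ∧ b.1 ≤ d ∧ lam d ≤ b.2 ∧ b.2 ≤ lam d + primeHeight lam d}

/-- The Dyck path of length `2 n` corresponding to the Young diagram `lam` contained in the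
staircase `δ_{n-1}` (the Dyck path is the silhouette of the Young diagram). -/
def toDyck (n : ℕ) (lam : ℕ → ℕ) : List Step :=
  ((List.range n).flatMap fun k =>
    List.replicate (lam (n - k) - lam (n - k + 1)) Step.E ++ [Step.N]) ++
    List.replicate (n - lam 1) Step.E

/-- The prime path of row `d` of the Young diagram `lam`, as its list of steps (read from its
lower-left endpoint). -/
def primePathList (lam : ℕ → ℕ) (d : ℕ) : List Step :=
  Step.N :: ((((List.range (primeHeight lam d - 1)).flatMap fun j =>
    List.replicate (lam (d - 1 - j) - lam (d - j)) Step.E ++ [Step.N])) ++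
    List.replicate (lam d + primeHeight lam d - lam (d - (primeHeight lam d - 1))) Step.E)

/-- `S` translates to `S'` by `p` units down and `q` units to the right. -/
def TranslatesBy (p q : ℤ) (S S' : Set (ℕ × ℕ)) : Prop :=
  ∀ x y : ℕ, (x, y) ∈ S' ↔ ∃ a b : ℕ, (a, b) ∈ S ∧ (x : ℤ) = a + p ∧ (y : ℤ) = b + q

/-- `S` translates to `S'`. -/
def Translates (S S' : Set (ℕ × ℕ)) : Prop := ∃ p q : ℤ, TranslatesBy p q S S'

/-- The length of a tableau: its number of distinct labels (for an honest tableau, labels are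
exactly `1, …, tlen f`). -/
def tlen (f : ℕ × ℕ → ℕ) : ℕ := sSup {v | v ≠ 0 ∧ ∃ b, f b = v}

/-- The number of boxes in row `x` of a tableau. -/
def rowLen (f : ℕ × ℕ → ℕ) (x : ℕ) : ℕ := sSup {y | f (x, y) ≠ 0}

/-- The number of boxes in column `y` of a tableau. -/
def colLen (f : ℕ × ℕ → ℕ) (y : ℕ) : ℕ := sSup {x | f (x, y) ≠ 0}

/-- `f` is (the entry function of) a tableau: the support is a Young diagram (1-indexed),
rows strictly increase, columns weakly increase, and the set of labels is exactly
`{1, …, tlen f}`. -/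
def IsTableau (f : ℕ × ℕ → ℕ) : Prop :=
  (∀ y, f (0, y) = 0) ∧ (∀ x, f (x, 0) = 0) ∧
  {b : ℕ × ℕ | f b ≠ 0}.Finite ∧
  (∀ x y x' y', 1 ≤ x' → x' ≤ x → 1 ≤ y' → y' ≤ y → f (x, y) ≠ 0 → f (x', y') ≠ 0) ∧
  (∀ x y, f (x, y) ≠ 0 → f (x, y + 1) ≠ 0 → f (x, y) < f (x, y + 1)) ∧
  (∀ x y, f (x, y) ≠ 0 → f (x + 1, y) ≠ 0 → f (x, y) ≤ f (x + 1, y)) ∧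
  (∀ v, 1 ≤ v → (v ≤ tlen f ↔ ∃ b, f b = v))

/-- `T^(r)`: the subtableau of all entries at most `r`. -/
def trunc (f : ℕ × ℕ → ℕ) (r : ℕ) : ℕ × ℕ → ℕ := fun b => if f b ≤ r then f b else 0

/-- The shape (row-length function) of a tableau. -/
def shapeOf (f : ℕ × ℕ → ℕ) : ℕ → ℕ := fun x => rowLen f x

/-- The row index of the end-box of the `k`-set of `f` (the maximal row index of a box
labeled `k`). -/
def endRow (f : ℕ × ℕ → ℕ) (k : ℕ) : ℕ := sSup {x | ∃ y, f (x, y) = k}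

/-- `Y 0 ⋗ Y 1 ⋗ ⋯ ⋗ Y l` is a saturated chain in the Tamari order on Young diagrams whose
maximal element `Y 0` is the empty diagram (each `Y r` covers `Y (r+1)`). -/
def IsTamariChain (Y : ℕ → ℕ → ℕ) (l : ℕ) : Prop :=
  (∀ r, r ≤ l → IsDiagram (Y r)) ∧ (∀ x, Y 0 x = 0) ∧
    ∀ r, r < l → TamariCoverY (Y r) (Y (r + 1))

/-- The tableau `ψ(C)` of the saturated chain `C = (∅ = Y 0 ⋗ ⋯ ⋗ Y l)`: the boxes removed in
the transition `Y (r-1) ⋗ Y r` are labeled `r`; that is, each box of `Y l` is labeled by the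
least `r` such that the box belongs to `Y r`. -/
def psiFun (Y : ℕ → ℕ → ℕ) (l : ℕ) : ℕ × ℕ → ℕ := fun b =>
  if 1 ≤ b.1 ∧ 1 ≤ b.2 ∧ b.2 ≤ Y l b.1 then sInf {r | r ≤ l ∧ b.2 ≤ Y r b.1} else 0

/-- `f` is a `ψ`-tableau: it is in the image of `ψ`. -/
def IsPsiTab (f : ℕ × ℕ → ℕ) : Prop :=
  ∃ l Y, IsTamariChain Y l ∧ f = psiFun Y l

/-- Row lengths of the staircase shape `δ_{n-1} = (n-1, n-2, …, 1)`: row `x ≥ 1` has `n - x`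
boxes. -/
def dstair (n : ℕ) : ℕ → ℕ := fun x => if x = 0 then 0 else n - x

/-- `C_i(n)`, via `ψ`: the set of maximal chains of length `n + i` in the Tamari lattice `T_n`,
identified with the `ψ`-tableaux of length `n + i` and shape `δ_{n-1}`. -/
def MemC (i : ℤ) (n : ℕ) (f : ℕ × ℕ → ℕ) : Prop :=
  IsTableau f ∧ IsPsiTab f ∧ (∀ x, rowLen f x = dstair n x) ∧ (tlen f : ℤ) = (n : ℤ) + i

/-- The `r`-set of `f` (of shape `δ_{n-1}`) is a full-set with end-box `(k, n - k)`:
it begins in row `1` and ends in the outer diagonal, at the box `(k, n - k)`. -/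
def HasFullSetAt (f : ℕ × ℕ → ℕ) (n r k : ℕ) : Prop :=
  (∃ y, f (1, y) = r) ∧ 1 ≤ k ∧ k ≤ n - 1 ∧ f (k, n - k) = r ∧
    ∀ x y, f (x, y) = r → x ≤ k

/-- `f` has an `r`-full-set. -/
def HasFullSet (f : ℕ × ℕ → ℕ) (n r : ℕ) : Prop := ∃ k, HasFullSetAt f n r k

/-- `f` has an `r⁺`-full-set (plus-full-set): an `r`-full-set whose end-box `(k, n-k)` satisfies
`k = n - 1`, or `k ≤ n - 2` and the southwest neighbor has a smaller label. -/
def HasPlusFullSet (f : ℕ × ℕ → ℕ) (n r : ℕ) : Prop :=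
  ∃ k, HasFullSetAt f n r k ∧ (k = n - 1 ∨ (k ≤ n - 2 ∧ f (k + 1, n - k - 1) < r))

/-- `F_i^r(n)`: the set of `C ∈ C_i(n)` whose `r`-set is a plus-full-set and whose `j`-set is
not a plus-full-set for any `j ∈ [r-1]`. -/
def MemF (i : ℤ) (n : ℕ) (r : ℕ) (f : ℕ × ℕ → ℕ) : Prop :=
  MemC i n f ∧ HasPlusFullSet f n r ∧ ∀ j, 1 ≤ j → j < r → ¬ HasPlusFullSet f n j

/-- `N_i(n)`: the set of `C ∈ C_i(n)` having no plus-full-sets. -/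
def MemN (i : ℤ) (n : ℕ) (f : ℕ × ℕ → ℕ) : Prop :=
  MemC i n f ∧ ∀ r, ¬ HasPlusFullSet f n r

/-- `α_d`: shift all rows of index greater than `d` down one row and repeat row `d` in
row `d + 1`. -/
def alphaFun (d : ℕ) (f : ℕ × ℕ → ℕ) : ℕ × ℕ → ℕ := fun b =>
  if b.1 ≤ d then f b else f (b.1 - 1, b.2)

/-- `β_d`: append a box labeled `tlen f + 1` at the end of each of the rows `1, …, d`. -/
def betaFun (d : ℕ) (f : ℕ × ℕ → ℕ) : ℕ × ℕ → ℕ := fun b =>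
  if 1 ≤ b.1 ∧ b.1 ≤ d ∧ b.2 = rowLen f b.1 + 1 then tlen f + 1 else f b

/-- The number of boxes of row `x` of `f` whose label is at most `r` (these occupy an initial
segment of the row). -/
def lowLen (f : ℕ × ℕ → ℕ) (r x : ℕ) : ℕ := sSup {y | f (x, y) ≠ 0 ∧ f (x, y) ≤ r}

/-- The row index `d` used in the definition of `Ĉ(r)`: the minimal `k ∈ [n-1]` with
`C (k, n-k) ≤ r` if such `k` exists, and `n` otherwise. -/
def hatD (f : ℕ × ℕ → ℕ) (n r : ℕ) : ℕ :=
  sInf ({k | 1 ≤ k ∧ k ≤ n - 1 ∧ 1 ≤ f (k, n - k) ∧ f (k, n - k) ≤ r} ∪ {n})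

/-- `Ĉ(r)` for `C ∈ C_i(n)` and `0 ≤ r ≤ n + i`: starting from `β_d(α_d(C^(r)))` (where `d` is
as in `hatD`), the entries of `C` greater than `r` of row index less than `d` are translated one
unit to the right, those of row index greater than `d` are translated one unit down, and all
these labels are incremented by one. -/
def hatFun (f : ℕ × ℕ → ℕ) (n r : ℕ) : ℕ × ℕ → ℕ := fun b =>
  let d := hatD f n r
  let x := b.1
  let y := b.2
  if x = 0 ∨ y = 0 then 0
  else if x ≤ d then
    if f (x, y) ≠ 0 ∧ f (x, y) ≤ r then f (x, y)
    else if y = lowLen f r x + 1 then r + 1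
    else if r < f (x, y - 1) then f (x, y - 1) + 1
    else 0
  else if x = d + 1 then f (d, y)
  else if f (x - 1, y) = 0 then 0
  else if f (x - 1, y) ≤ r then f (x - 1, y)
  else f (x - 1, y) + 1

/-- `RepBy i m t r C0 C` : `C = (φ_{i,m+t-1}^{r 1} ∘ φ_{i,m+t-2}^{r 2} ∘ ⋯ ∘ φ_{i,m}^{r t}) C0`,
each factor being applied within its domain. -/
def RepBy (i : ℤ) (m t : ℕ) (r : ℕ → ℕ) (C0 C : ℕ × ℕ → ℕ) : Prop :=
  ∃ D : ℕ → ℕ × ℕ → ℕ, D 0 = C0 ∧ D t = C ∧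
    ∀ s, s < t →
      MemC i (m + s) (D s) ∧
      ((r (t - s) : ℤ) ≤ (m : ℤ) + s + i) ∧
      (∀ j, 1 ≤ j → j ≤ r (t - s) → ¬ HasPlusFullSet (D s) (m + s) j) ∧
      D (s + 1) = hatFun (D s) (m + s) (r (t - s))

/-- The set `𝕏_{d,n-1}^r` of Theorem 4.3: `ψ`-tableaux of length `r`, contained in `δ_{n-1}`,
whose row `d` has length `n - d` and whose prime path of row `d` has height `d`. -/
def MemX (d n r : ℕ) (f : ℕ × ℕ → ℕ) : Prop :=
  IsTableau f ∧ IsPsiTab f ∧ tlen f = r ∧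
    (∀ x, 1 ≤ x → rowLen f x ≤ n - x) ∧
    rowLen f d = n - d ∧
    primeHeight (shapeOf f) d = d

/-- The set `ℤ_{d,n}^{r+1}` of Theorem 4.3: `ψ`-tableaux of length `r + 1`, contained in `δ_n`,
such that rows `d` and `d+1` of the truncation at `r` are identical, the end-box of the
`(r+1)`-set is `(d, n-d+1)`, and the prime path of `(d, n-d+1)` has height `d`. -/
def MemZ (d n r : ℕ) (g : ℕ × ℕ → ℕ) : Prop :=
  IsTableau g ∧ IsPsiTab g ∧ tlen g = r + 1 ∧
    (∀ x, 1 ≤ x → rowLen g x ≤ n + 1 - x) ∧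
    (∀ y, trunc g r (d, y) = trunc g r (d + 1, y)) ∧
    g (d, n - d + 1) = r + 1 ∧ (∀ x y, g (x, y) = r + 1 → x ≤ d) ∧
    primeHeight (shapeOf g) d = d

/-! ### Chains -/

/-- Explicit form of the covering relation: rows `s+1, …, e` lose a box. -/
def Cov (mu lam : ℕ → ℕ) (s e : ℕ) : Prop :=
  s < e ∧ lam (e + 1) < lam e ∧ (∀ x, s < x → x < e → lam x + x < lam e + e) ∧
    (s = 0 ∨ lam e + e ≤ lam s + s) ∧
    ∀ x, lam x = if s < x ∧ x ≤ e then mu x + 1 else mu x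

lemma diag_anti {lam : ℕ → ℕ} (h : IsDiagram lam) {x y : ℕ} (hx : 1 ≤ x) (hxy : x ≤ y) :
    lam y ≤ lam x := by
  induction y, hxy using Nat.le_induction with
  | base => exact le_rfl
  | succ y hy ih => exact (h.2.1 y (by omega)).trans ih

lemma cover_iff {mu lam : ℕ → ℕ} (h : IsDiagram lam) :
    TamariCoverY mu lam ↔ ∃ s e, Cov mu lam s e := by
  constructor
  · rintro ⟨d, ⟨hd1, hd2, hd3⟩, rfl⟩
    have hne : {t | 1 ≤ t ∧ (t = d ∨ (t < d ∧ lam d + t ≤ lam (d - t)))}.Nonempty :=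
      ⟨d, hd1, Or.inl rfl⟩
    have hm := Nat.sInf_mem hne
    have hmin : ∀ t, t < primeHeight lam d →
        ¬ (1 ≤ t ∧ (t = d ∨ (t < d ∧ lam d + t ≤ lam (d - t)))) :=
      fun t ht => Nat.notMem_of_lt_sInf ht
    change 1 ≤ primeHeight lam d ∧ (primeHeight lam d = d ∨ (primeHeight lam d < d ∧
      lam d + primeHeight lam d ≤ lam (d - primeHeight lam d))) at hm
    obtain ⟨hm1, hm2⟩ := hm
    unfold removeStrip
    generalize primeHeight lam d = t at *
    refine ⟨d - t, d, by omega, hd3, ?_, ?_, ?_⟩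
    · intro x hx hxd
      have := hmin (d - x) (by omega)
      have e : d - (d - x) = x := by omega
      rw [e] at this
      omega
    · omega
    · intro x
      by_cases hx : d + 1 ≤ x + t ∧ x ≤ d
      · have hx0 : 1 ≤ x := by omega
        have := diag_anti h hx0 hx.2
        have hx' : d - t < x ∧ x ≤ d := by omega
        simp only [hx, hx', and_self, if_true]
        omega
      · have hx' : ¬ (d - t < x ∧ x ≤ d) := by omega
        simp only [hx, hx', if_false]
  · rintro ⟨s, e, h1, h2, h3, h4, h5⟩
    have hp : primeHeight lam e = e - s := by
      apply le_antisymm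
      · apply Nat.sInf_le
        refine ⟨by omega, ?_⟩
        have e1 : e - (e - s) = s := by omega
        rw [e1]
        omega
      · refine le_csInf (s := {t | 1 ≤ t ∧ (t = e ∨ (t < e ∧ lam e + t ≤ lam (e - t)))})
          ⟨e, by omega, Or.inl rfl⟩ ?_
        rintro t ⟨ht1, ht2⟩
        by_contra hlt
        have := h3 (e - t) (by omega) (by omega)
        omega
    refine ⟨e, ⟨by omega, by omega, h2⟩, ?_⟩
    funext x
    have := h5 x
    unfold removeStrip
    rw [hp]
    split_ifs at this ⊢ <;> omega

/-- A maximal chain of `T_n` of length `l`. -/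
structure Chn (Y : ℕ → ℕ → ℕ) (l n : ℕ) : Prop where
  diag : ∀ r, r ≤ l → IsDiagram (Y r)
  zero : ∀ x, Y 0 x = 0
  step : ∀ r, r < l → ∃ s e, Cov (Y r) (Y (r + 1)) s e
  top : ∀ x, Y l x = dstair n x

lemma chn_mono {Y : ℕ → ℕ → ℕ} {l : ℕ} (step : ∀ r, r < l → ∃ s e, Cov (Y r) (Y (r + 1)) s e)
    {j k : ℕ} (hjk : j ≤ k) (hk : k ≤ l) (x : ℕ) : Y j x ≤ Y k x := by
  induction k, hjk using Nat.le_induction with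
  | base => exact le_rfl
  | succ k hjk ih =>
    obtain ⟨s, e, hc⟩ := step k (by omega)
    have := hc.2.2.2.2 x
    have := ih (by omega)
    split_ifs at * <;> omega

section psi

variable {Y : ℕ → ℕ → ℕ} {l : ℕ}

lemma psi_zero (hz : ∀ x, Y 0 x = 0) {x y : ℕ} :
    psiFun Y l (x, y) = 0 ↔ (x = 0 ∨ y = 0 ∨ Y l x < y) := by
  unfold psiFun
  dsimp only
  split_ifs with h
  · constructor
    · intro h0
      have hm := Nat.sInf_mem (s := {r | r ≤ l ∧ y ≤ Y r x}) ⟨l, le_rfl, h.2.2⟩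
      rw [h0] at hm
      have := hm.2
      rw [hz] at this
      omega
    · omega
  · constructor
    · omega
    · intro; rfl

lemma psi_le (step : ∀ r, r < l → ∃ s e, Cov (Y r) (Y (r + 1)) s e) (hz : ∀ x, Y 0 x = 0)
    {x y j : ℕ} (hx : 1 ≤ x) (hy : 1 ≤ y) (hj : j ≤ l) :
    (psiFun Y l (x, y) ≠ 0 ∧ psiFun Y l (x, y) ≤ j) ↔ y ≤ Y j x := by
  constructor
  · rintro ⟨h0, h1⟩
    rw [Ne, psi_zero hz] at h0
    unfold psiFun at h1
    dsimp only at h1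
    rw [if_pos (by omega)] at h1
    have hm := Nat.sInf_mem (s := {r | r ≤ l ∧ y ≤ Y r x}) ⟨l, le_rfl, by omega⟩
    exact hm.2.trans (chn_mono step h1 hj x)
  · intro h
    have := chn_mono step hj le_rfl x
    refine ⟨?_, ?_⟩
    · rw [Ne, psi_zero hz]; omega
    · unfold psiFun
      dsimp only
      rw [if_pos (by omega)]
      exact Nat.sInf_le ⟨hj, h⟩

lemma psi_le_len {x y : ℕ} : psiFun Y l (x, y) ≤ l := by
  unfold psiFun
  dsimp only
  split_ifs with h
  · exact Nat.sInf_le ⟨le_rfl, h.2.2⟩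
  · omega

lemma psi_eq (step : ∀ r, r < l → ∃ s e, Cov (Y r) (Y (r + 1)) s e) (hz : ∀ x, Y 0 x = 0)
    {x y j : ℕ} :
    psiFun Y l (x, y) = j + 1 ↔
      (1 ≤ x ∧ 1 ≤ y ∧ j < l ∧ Y j x < y ∧ y ≤ Y (j + 1) x) := by
  have h0 := psi_zero (Y := Y) (l := l) hz (x := x) (y := y)
  have hl := psi_le_len (Y := Y) (l := l) (x := x) (y := y)
  constructor
  · intro h
    have hx : 1 ≤ x := by omega
    have hy : 1 ≤ y := by omega
    have h1 := psi_le step hz hx hy (j := j) (by omega)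
    have h2 := psi_le step hz hx hy (j := j + 1) (by omega)
    omega
  · rintro ⟨hx, hy, hj, ha, hb⟩
    have h1 := psi_le step hz hx hy (j := j) (by omega)
    have h2 := psi_le step hz hx hy (j := j + 1) (by omega)
    omega

/-- Characterisation of `psiFun`. -/
lemma psi_unique (step : ∀ r, r < l → ∃ s e, Cov (Y r) (Y (r + 1)) s e) (hz : ∀ x, Y 0 x = 0)
    (f : ℕ × ℕ → ℕ)
    (h0 : ∀ x y, (x = 0 ∨ y = 0 ∨ Y l x < y) → f (x, y) = 0)
    (h1 : ∀ x y j, 1 ≤ x → 1 ≤ y → j < l → Y j x < y → y ≤ Y (j + 1) x → f (x, y) = j + 1) :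
    f = psiFun Y l := by
  funext ⟨x, y⟩
  rcases hp : psiFun Y l (x, y) with _ | j
  · exact h0 x y ((psi_zero hz).1 hp)
  · obtain ⟨a, b, c, d, e⟩ := (psi_eq step hz).1 hp
    exact h1 x y j a b c d e

lemma sSup_eq_of {S : Set ℕ} {m : ℕ} (h : ∀ y ∈ S, y ≤ m) (hm : m = 0 ∨ m ∈ S) :
    sSup S = m := by
  rcases hm with rfl | hm
  · rcases S.eq_empty_or_nonempty with rfl | hS
    · simp
    · exact Nat.le_zero.1 (csSup_le hS h)
  · exact le_antisymm (csSup_le ⟨m, hm⟩ h) (le_csSup ⟨m, h⟩ hm)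

lemma psi_lowLen (step : ∀ r, r < l → ∃ s e, Cov (Y r) (Y (r + 1)) s e) (hz : ∀ x, Y 0 x = 0)
    {x j : ℕ} (hx : 1 ≤ x) (hj : j ≤ l) : lowLen (psiFun Y l) j x = Y j x := by
  apply sSup_eq_of
  · intro y hy
    rcases Nat.eq_zero_or_pos y with rfl | hy0
    · omega
    · exact (psi_le step hz hx hy0 hj).1 hy
  · rcases Nat.eq_zero_or_pos (Y j x) with h | h
    · exact Or.inl h
    · exact Or.inr ((psi_le step hz hx h hj).2 le_rfl)

lemma psi_rowLen (diag : ∀ r, r ≤ l → IsDiagram (Y r)) (hz : ∀ x, Y 0 x = 0)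
    (x : ℕ) : rowLen (psiFun Y l) x = Y l x := by
  apply sSup_eq_of
  · intro y hy
    have := mt (psi_zero hz).2 hy
    omega
  · have h0 := (diag l le_rfl).1
    rcases Nat.eq_zero_or_pos (Y l x) with h | h
    · exact Or.inl h
    · right
      intro h'
      have := (psi_zero hz).1 h'
      rcases this with rfl | h | h <;> omega

lemma psi_exists (step : ∀ r, r < l → ∃ s e, Cov (Y r) (Y (r + 1)) s e) (hz : ∀ x, Y 0 x = 0)
    {j : ℕ} (hj : j < l) : ∃ b, psiFun Y l b = j + 1 := by
  obtain ⟨s, e, h1, h2, -, -, h5⟩ := step j hj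
  have := h5 e
  rw [if_pos (by omega)] at this
  exact ⟨(e, Y (j + 1) e), (psi_eq step hz).2 (by omega)⟩

lemma psi_tlen (step : ∀ r, r < l → ∃ s e, Cov (Y r) (Y (r + 1)) s e) (hz : ∀ x, Y 0 x = 0) :
    tlen (psiFun Y l) = l := by
  apply sSup_eq_of
  · rintro v ⟨-, ⟨x, y⟩, rfl⟩
    exact psi_le_len
  · rcases l with _ | l
    · exact Or.inl rfl
    · exact Or.inr ⟨by omega, psi_exists step hz (by omega)⟩

lemma psi_tableau (diag : ∀ r, r ≤ l → IsDiagram (Y r))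
    (step : ∀ r, r < l → ∃ s e, Cov (Y r) (Y (r + 1)) s e) (hz : ∀ x, Y 0 x = 0) :
    IsTableau (psiFun Y l) := by
  refine ⟨fun y => (psi_zero hz).2 (by omega), fun x => (psi_zero hz).2 (by omega), ?_, ?_, ?_,
    ?_, ?_⟩
  · obtain ⟨h0, -, N, hN⟩ := diag l le_rfl
    apply Set.Finite.subset ((Set.finite_Iic N).prod (Set.finite_Iic (Y l 1)))
    rintro ⟨x, y⟩ hxy
    have h := mt (psi_zero hz).2 hxy
    have h1 := diag_anti (diag l le_rfl) le_rfl (show 1 ≤ x by omega)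
    refine ⟨?_, ?_⟩
    · by_contra hx
      have := hN x (by simp at hx; omega)
      omega
    · simp; omega
  · intro x y x' y' h1 h2 h3 h4 h5
    have h := mt (psi_zero hz).2 h5
    have := diag_anti (diag l le_rfl) h1 h2
    rw [Ne, psi_zero hz]
    omega
  · intro x y h1 h2
    rcases hp : psiFun Y l (x, y) with _ | j
    · omega
    rcases hq : psiFun Y l (x, y + 1) with _ | k
    · omega
    have hp' := (psi_eq step hz).1 hp
    have hq' := (psi_eq step hz).1 hq
    by_contra hlt
    have := chn_mono step (show k + 1 ≤ j + 1 by omega) (by omega) x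
    obtain ⟨s, e, hc⟩ := step j (by omega)
    have := hc.2.2.2.2 x
    split_ifs at this <;> omega
  · intro x y h1 h2
    rcases hp : psiFun Y l (x, y) with _ | j
    · omega
    rcases hq : psiFun Y l (x + 1, y) with _ | k
    · omega
    have hp' := (psi_eq step hz).1 hp
    have hq' := (psi_eq step hz).1 hq
    by_contra hlt
    have := chn_mono step (show k + 1 ≤ j by omega) (by omega) x
    have := (diag (k + 1) (by omega)).2.1 x (by omega)
    omega
  · intro v hv
    rw [psi_tlen step hz]
    constructor
    · intro h
      obtain ⟨j, rfl⟩ : ∃ j, v = j + 1 := ⟨v - 1, by omega⟩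
      exact psi_exists step hz (by omega)
    · rintro ⟨⟨x, y⟩, rfl⟩
      exact psi_le_len

end psi

lemma memC_iff {i : ℤ} {n : ℕ} {f : ℕ × ℕ → ℕ} :
    MemC i n f ↔ ∃ Y l, Chn Y l n ∧ (l : ℤ) = n + i ∧ f = psiFun Y l := by
  constructor
  · rintro ⟨-, ⟨l, Y, ⟨hd, hz, hs⟩, rfl⟩, h3, h4⟩
    have hs' : ∀ r, r < l → ∃ s e, Cov (Y r) (Y (r + 1)) s e :=
      fun r hr => (cover_iff (hd (r + 1) hr)).1 (hs r hr)
    refine ⟨Y, l, ⟨hd, hz, hs', ?_⟩, ?_, rfl⟩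
    · intro x
      rw [← h3, psi_rowLen hd hz]
    · rw [← h4, psi_tlen hs' hz]
  · rintro ⟨Y, l, hc, hl, rfl⟩
    refine ⟨psi_tableau hc.diag hc.step hc.zero, ⟨l, Y, ⟨hc.diag, hc.zero, ?_⟩, rfl⟩, ?_, ?_⟩
    · intro r hr
      exact (cover_iff (hc.diag (r + 1) hr)).2 (hc.step r hr)
    · intro x
      rw [psi_rowLen hc.diag hc.zero, hc.top]
    · rw [psi_tlen hc.step hc.zero, hl]

lemma psi_congr {Y Z : ℕ → ℕ → ℕ} {l : ℕ} (h : ∀ j, j ≤ l → ∀ x, Y j x = Z j x) :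
    psiFun Y l = psiFun Z l := by
  funext ⟨x, y⟩
  unfold psiFun
  dsimp only
  rw [h l le_rfl]
  have : {r | r ≤ l ∧ y ≤ Y r x} = {r | r ≤ l ∧ y ≤ Z r x} := by
    ext r
    constructor
    · rintro ⟨a, b⟩; exact ⟨a, by rw [← h r a]; exact b⟩
    · rintro ⟨a, b⟩; exact ⟨a, by rw [h r a]; exact b⟩
  rw [this]

lemma psi_inj {Y Z : ℕ → ℕ → ℕ} {l n : ℕ} (hY : Chn Y l n) (hZ : Chn Z l n)
    (h : psiFun Y l = psiFun Z l) {j : ℕ} (hj : j ≤ l) (x : ℕ) : Y j x = Z j x := by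
  rcases Nat.eq_zero_or_pos x with rfl | hx
  · rw [(hY.diag j hj).1, (hZ.diag j hj).1]
  · rw [← psi_lowLen hY.step hY.zero hx hj, ← psi_lowLen hZ.step hZ.zero hx hj, h]

/-! ### Containment in the staircase -/

lemma Chn.le_stair {Y : ℕ → ℕ → ℕ} {l n : ℕ} (hY : Chn Y l n) {j : ℕ} (hj : j ≤ l) {x : ℕ}
    (hx : 1 ≤ x) : Y j x ≤ n - x := by
  have h1 := chn_mono hY.step hj le_rfl x
  have h2 := hY.top x
  unfold dstair at h2
  rw [if_neg (by omega)] at h2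
  omega

lemma Chn.top' {Y : ℕ → ℕ → ℕ} {l n : ℕ} (hY : Chn Y l n) {x : ℕ}
    (hx : 1 ≤ x) : Y l x = n - x := by
  rw [hY.top]
  unfold dstair
  rw [if_neg (by omega)]

/-- Plus-full-sets, in terms of chains. -/
def PF (Y : ℕ → ℕ → ℕ) (n j : ℕ) : Prop :=
  ∃ k, Cov (Y j) (Y (j + 1)) 0 k ∧ k + 1 ≤ n ∧ Y (j + 1) k + k = n ∧ Y (j + 1) (k + 1) + k + 1 = n

lemma plus_iff {Y : ℕ → ℕ → ℕ} {l n : ℕ} (hY : Chn Y l n) {j : ℕ} (hj : j < l) :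
    HasPlusFullSet (psiFun Y l) n (j + 1) ↔ PF Y n j := by
  have hE : ∀ x y, psiFun Y l (x, y) = j + 1 ↔
      (1 ≤ x ∧ 1 ≤ y ∧ j < l ∧ Y j x < y ∧ y ≤ Y (j + 1) x) :=
    fun x y => psi_eq hY.step hY.zero
  constructor
  · rintro ⟨k, ⟨⟨y, hy⟩, hk1, hk2, hk3, hk4⟩, hk5⟩
    obtain ⟨s, e, hc⟩ := hY.step j hj
    rw [hE] at hy hk3
    have hc' := hc
    obtain ⟨c1, c2, c3, c4, c5⟩ := hc
    have a1 := c5 1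
    have a2 := c5 k
    have a3 := c5 e
    rw [if_pos (by omega)] at a3
    have a4 := hk4 e (Y (j + 1) e) ((hE _ _).2 (by omega))
    split_ifs at a1 a2
    any_goals omega
    have hs : s = 0 := by omega
    have hke : k = e := by omega
    subst hs hke
    have b1 := hY.le_stair (j := j + 1) (by omega) hk1
    refine ⟨k, hc', by omega, by omega, ?_⟩
    have b2 := hY.le_stair (j := j + 1) (by omega) (show 1 ≤ k + 1 by omega)
    rcases hk5 with h | ⟨h, h'⟩
    · omega
    · have := c5 (k + 1)
      rw [if_neg (by omega)] at this
      have z := psi_zero (Y := Y) (l := l) hY.zero (x := k + 1) (y := n - k - 1)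
      have t := hY.top' (x := k + 1) (by omega)
      have := psi_le hY.step hY.zero (x := k + 1) (y := n - k - 1) (j := j) (by omega) (by omega)
        (by omega)
      omega
  · rintro ⟨k, hc, h1, h2, h3⟩
    obtain ⟨c1, c2, c3, c4, c5⟩ := hc
    have a1 := c5 1
    have a2 := c5 k
    rw [if_pos (by omega)] at a1 a2
    refine ⟨k, ⟨⟨Y (j + 1) 1, (hE _ _).2 (by omega)⟩, by omega, by omega, (hE _ _).2 (by omega),
      ?_⟩, ?_⟩
    · intro x y hxy
      rw [hE] at hxy
      have := c5 x
      split_ifs at this <;> omega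
    · by_cases hk : k = n - 1
      · exact Or.inl hk
      · right
        refine ⟨by omega, ?_⟩
        have := c5 (k + 1)
        rw [if_neg (by omega)] at this
        have := psi_le hY.step hY.zero (x := k + 1) (y := n - k - 1) (j := j) (by omega) (by omega)
          (by omega)
        omega

/-! ### Inserting and deleting rows -/

/-- Repeat row `d`. -/
def ins (d : ℕ) (lam : ℕ → ℕ) : ℕ → ℕ := fun x => if x ≤ d then lam x else lam (x - 1)

/-- Repeat row `d` and add a box to each of the rows `1, …, d`. -/
def ins1 (d : ℕ) (lam : ℕ → ℕ) : ℕ → ℕ := fun x =>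
  if x = 0 then 0 else if x ≤ d then lam x + 1 else lam (x - 1)

/-- Delete row `d + 1`. -/
def del (d : ℕ) (lam : ℕ → ℕ) : ℕ → ℕ := fun x => if x ≤ d then lam x else lam (x + 1)

/-- Delete row `d + 1` and remove a box from each of the rows `1, …, d`. -/
def del1 (d : ℕ) (lam : ℕ → ℕ) : ℕ → ℕ := fun x => if x ≤ d then lam x - 1 else lam (x + 1)

/-- The chain of `Ĉ(r)`. -/
def hatY (Y : ℕ → ℕ → ℕ) (d r : ℕ) : ℕ → ℕ → ℕ := fun j =>
  if j ≤ r then ins d (Y j) else ins1 d (Y (j - 1))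

/-- The inverse construction. -/
def unY (Z : ℕ → ℕ → ℕ) (d r : ℕ) : ℕ → ℕ → ℕ := fun j =>
  if j ≤ r then del d (Z j) else del1 d (Z (j + 1))

/-- The prime path of row `d` has height `d`. -/
def Hp (lam : ℕ → ℕ) (d : ℕ) : Prop := ∀ x, 1 ≤ x → x < d → lam x + x < lam d + d

lemma Cov.app {mu lam : ℕ → ℕ} {s e : ℕ} (hc : Cov mu lam s e) (x : ℕ) :
    (s < x ∧ x ≤ e ∧ lam x = mu x + 1) ∨ ((x ≤ s ∨ e < x) ∧ lam x = mu x) := by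
  have := hc.2.2.2.2 x
  split_ifs at this <;> omega

lemma back_eq {mu lam : ℕ → ℕ} {s e d : ℕ} (hm : IsDiagram mu) (hc : Cov mu lam s e) (hd : 1 ≤ d)
    (h : lam d = lam (d + 1)) : mu d = mu (d + 1) := by
  have h1 := hm.2.1 d hd
  have a1 := hc.app d
  have a2 := hc.app (d + 1)
  obtain ⟨c1, c2, c3, c4, c5⟩ := hc
  by_contra hne
  have hs : s = d := by omega
  subst hs
  rcases Nat.lt_or_ge (s + 1) e with he | he
  · have := c3 (s + 1) (by omega) he
    omega
  · have : e = s + 1 := by omega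
    subst this
    omega

lemma Hp.zero {mu lam : ℕ → ℕ} {s e d : ℕ} (hc : Cov mu lam s e) (h : Hp lam d) (h1 : s < d)
    (h2 : d ≤ e) : s = 0 := by
  obtain ⟨c1, c2, c3, c4, c5⟩ := hc
  by_contra hs
  have := h s (by omega) h1
  rcases Nat.lt_or_ge d e with he | he
  · have := c3 d h1 he
    omega
  · have : e = d := by omega
    subst this
    omega

lemma Hp.back {mu lam : ℕ → ℕ} {s e d : ℕ} (hc : Cov mu lam s e) (h : Hp lam d) : Hp mu d := by
  intro x hx hxd
  have h1 := h x hx hxd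
  have a1 := hc.app x
  have a2 := hc.app d
  have := h.zero hc
  omega

lemma ins_diag {lam : ℕ → ℕ} (h : IsDiagram lam) (d : ℕ) (hd : 1 ≤ d) : IsDiagram (ins d lam) := by
  obtain ⟨h0, h1, N, hN⟩ := h
  refine ⟨by simp [ins, h0], ?_, N + d + 2, ?_⟩
  · intro x hx
    unfold ins
    have := h1 x hx
    have := h1 (x - 1)
    have e1 : x + 1 - 1 = x := by omega
    rw [e1]
    split_ifs
    · omega
    · omega
    · omega
    · rw [show x - 1 + 1 = x by omega] at this
      exact this (by omega)
  · intro x hx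
    unfold ins
    rw [if_neg (by omega)]
    exact hN _ (by omega)

lemma ins1_diag {lam : ℕ → ℕ} (h : IsDiagram lam) (d : ℕ) (hd : 1 ≤ d) :
    IsDiagram (ins1 d lam) := by
  obtain ⟨h0, h1, N, hN⟩ := h
  refine ⟨by simp [ins1], ?_, N + d + 2, ?_⟩
  · intro x hx
    unfold ins1
    have := h1 x hx
    have := h1 (x - 1)
    have e1 : x + 1 - 1 = x := by omega
    rw [e1]
    split_ifs
    any_goals omega
    rw [show x - 1 + 1 = x by omega] at this
    exact this (by omega)
  · intro x hx
    unfold ins1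
    rw [if_neg (by omega), if_neg (by omega)]
    exact hN _ (by omega)

lemma del_diag {lam : ℕ → ℕ} (h : IsDiagram lam) (d : ℕ) : IsDiagram (del d lam) := by
  obtain ⟨h0, h1, N, hN⟩ := h
  refine ⟨by simp [del, h0], ?_, N + d + 2, ?_⟩
  · intro x hx
    unfold del
    have := h1 x hx
    have := h1 (x + 1) (by omega)
    split_ifs <;> omega
  · intro x hx
    unfold del
    rw [if_neg (by omega)]
    exact hN _ (by omega)

lemma del1_diag {lam : ℕ → ℕ} (h : IsDiagram lam) (d : ℕ) (h2 : lam (d + 1) < lam d) :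
    IsDiagram (del1 d lam) := by
  obtain ⟨h0, h1, N, hN⟩ := h
  refine ⟨by simp [del1, h0], ?_, N + d + 2, ?_⟩
  · intro x hx
    unfold del1
    have := h1 x hx
    have := h1 (x + 1) (by omega)
    split_ifs
    · omega
    · omega
    · have : x = d := by omega
      subst this
      omega
    · omega
  · intro x hx
    unfold del1
    rw [if_neg (by omega)]
    exact hN _ (by omega)

lemma ins_cov_hi0 {mu lam : ℕ → ℕ} {e d : ℕ} (hc : Cov mu lam 0 e) (hd : 1 ≤ d) (h : d ≤ e) :
    Cov (ins d mu) (ins d lam) 0 (e + 1) := by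
  have ha := fun x => hc.app x
  obtain ⟨c1, c2, c3, c4, c5⟩ := hc
  unfold Cov ins
  refine ⟨by omega, ?_, ?_, Or.inl rfl, ?_⟩
  · simp only [Nat.add_sub_cancel]
    rw [if_neg (by omega), if_neg (by omega)]
    exact c2
  · intro x hx hxe
    simp only [Nat.add_sub_cancel]
    rw [if_neg (show ¬ (e + 1 ≤ d) by omega)]
    split_ifs with hxd
    · rcases Nat.lt_or_ge x e with h' | h'
      · have := c3 x hx h'; omega
      · have : x = e := by omega
        subst this; omega
    · rcases Nat.lt_or_ge (x - 1) e with h' | h'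
      · have := c3 (x - 1) (by omega) h'; omega
      · omega
  · intro x
    have a1 := ha x
    have a2 := ha (x - 1)
    split_ifs <;> omega

lemma ins_cov_hi {mu lam : ℕ → ℕ} {s e d : ℕ} (hc : Cov mu lam s e) (hd : 1 ≤ d) (h : d ≤ s) :
    Cov (ins d mu) (ins d lam) (s + 1) (e + 1) := by
  have ha := fun x => hc.app x
  obtain ⟨c1, c2, c3, c4, c5⟩ := hc
  unfold Cov ins
  refine ⟨by omega, ?_, ?_, ?_, ?_⟩
  · simp only [Nat.add_sub_cancel]
    rw [if_neg (by omega), if_neg (by omega)]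
    exact c2
  · intro x hx hxe
    simp only [Nat.add_sub_cancel]
    rw [if_neg (show ¬ (e + 1 ≤ d) by omega), if_neg (by omega)]
    have := c3 (x - 1) (by omega) (by omega)
    omega
  · simp only [Nat.add_sub_cancel]
    rw [if_neg (show ¬ (e + 1 ≤ d) by omega), if_neg (by omega)]
    omega
  · intro x
    have a1 := ha x
    have a2 := ha (x - 1)
    split_ifs <;> omega

lemma ins_cov_lo {mu lam : ℕ → ℕ} {s e d : ℕ} (hc : Cov mu lam s e) (h : e < d) :
    Cov (ins d mu) (ins d lam) s e := by
  have ha := fun x => hc.app x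
  obtain ⟨c1, c2, c3, c4, c5⟩ := hc
  unfold Cov ins
  refine ⟨c1, ?_, ?_, ?_, ?_⟩
  · rw [if_pos (by omega), if_pos (by omega)]
    exact c2
  · intro x hx hxe
    rw [if_pos (by omega), if_pos (by omega)]
    exact c3 x hx hxe
  · rw [if_pos (by omega), if_pos (by omega)]
    exact c4
  · intro x
    have a1 := ha x
    have a2 := ha (x - 1)
    split_ifs <;> omega

lemma ins_cov {mu lam : ℕ → ℕ} {s e d : ℕ} (hc : Cov mu lam s e) (hd : 1 ≤ d) (hp : Hp lam d) :
    ∃ s' e', Cov (ins d mu) (ins d lam) s' e' := by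
  rcases Nat.lt_or_ge e d with h | h
  · exact ⟨_, _, ins_cov_lo hc h⟩
  · rcases Nat.lt_or_ge s d with h' | h'
    · have := hp.zero hc h' h
      subst this
      exact ⟨_, _, ins_cov_hi0 hc hd h⟩
    · exact ⟨_, _, ins_cov_hi hc hd h'⟩

lemma ins1_cov {mu lam : ℕ → ℕ} {s e d : ℕ} (hc : Cov mu lam s e) (hd : 1 ≤ d)
    (hp : lam d = mu d) : ∃ s' e', Cov (ins1 d mu) (ins1 d lam) s' e' := by
  have ha := fun x => hc.app x
  have h0 := ha d
  obtain ⟨c1, c2, c3, c4, c5⟩ := hc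
  rcases Nat.lt_or_ge e d with h | h
  · refine ⟨s, e, c1, ?_, ?_, ?_, ?_⟩
    · unfold ins1
      rw [if_neg (by omega), if_pos (by omega), if_neg (by omega), if_pos (by omega)]
      omega
    · intro x hx hxe
      unfold ins1
      rw [if_neg (by omega), if_pos (by omega), if_neg (by omega), if_pos (by omega)]
      have := c3 x hx hxe
      omega
    · unfold ins1
      rcases c4 with c4 | c4
      · exact Or.inl c4
      · by_cases hs : s = 0
        · exact Or.inl hs
        · right
          rw [if_neg (by omega), if_pos (by omega), if_neg (by omega), if_pos (by omega)]
          omega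
    · intro x
      have a1 := ha x
      have a2 := ha (x - 1)
      unfold ins1
      split_ifs <;> omega
  · refine ⟨s + 1, e + 1, by omega, ?_, ?_, ?_, ?_⟩
    · unfold ins1
      simp only [Nat.add_sub_cancel]
      rw [if_neg (by omega), if_neg (by omega), if_neg (by omega), if_neg (by omega)]
      exact c2
    · intro x hx hxe
      unfold ins1
      simp only [Nat.add_sub_cancel]
      rw [if_neg (by omega), if_neg (by omega), if_neg (by omega), if_neg (by omega)]
      have := c3 (x - 1) (by omega) (by omega)
      omega
    · unfold ins1
      simp only [Nat.add_sub_cancel]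
      rw [if_neg (by omega), if_neg (by omega), if_neg (by omega), if_neg (by omega)]
      omega
    · intro x
      have a1 := ha x
      have a2 := ha (x - 1)
      unfold ins1
      split_ifs <;> omega

lemma del_cov_hi0 {mu lam : ℕ → ℕ} {e d : ℕ} (hc : Cov mu lam 0 e) (hd : 1 ≤ d) (h : d + 1 ≤ e)
    (hp : Hp lam d) (heq : lam d = lam (d + 1)) :
    Cov (del d mu) (del d lam) 0 (e - 1) := by
  have ha := fun x => hc.app x
  have key : (if e - 1 ≤ d then lam (e - 1) else lam (e - 1 + 1)) = lam e := by
    split_ifs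
    · have : e = d + 1 := by omega
      subst this
      simpa using heq
    · congr 1; omega
  obtain ⟨c1, c2, c3, c4, c5⟩ := hc
  have hde : lam d + d + 1 ≤ lam e + e := by
    rcases Nat.lt_or_ge (d + 1) e with h' | h'
    · have := c3 (d + 1) (by omega) h'; omega
    · have : e = d + 1 := by omega
      subst this; omega
  unfold Cov del
  refine ⟨by omega, ?_, ?_, Or.inl rfl, ?_⟩
  · rw [key, if_neg (by omega), show e - 1 + 1 + 1 = e + 1 by omega]
    exact c2
  · intro x hx hxe
    rw [key]
    split_ifs with hxd
    · rcases Nat.lt_or_ge x d with h' | h'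
      · have := hp x hx h'; omega
      · have : x = d := by omega
        have q := c3 (x + 1) (by omega) (by omega)
        subst this; omega
    · have := c3 (x + 1) (by omega) (by omega); omega
  · intro x
    have a1 := ha x
    have a2 := ha (x + 1)
    split_ifs <;> omega

lemma del_cov {mu lam : ℕ → ℕ} {s e d : ℕ} (hm : IsDiagram mu) (hc : Cov mu lam s e) (hd : 1 ≤ d)
    (hp : Hp lam d) (heq : lam d = lam (d + 1)) :
    ∃ s' e', Cov (del d mu) (del d lam) s' e' := by
  have ha := fun x => hc.app x
  have hb := back_eq hm hc hd heq
  have hz := hp.zero hc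
  have h0 := ha d
  have h0' := ha (d + 1)
  rcases Nat.lt_or_ge d e with h | h
  · rcases Nat.lt_or_ge s d with h' | h'
    · have := hz h' (by omega)
      subst this
      exact ⟨_, _, del_cov_hi0 hc hd h hp heq⟩
    · have hs : d < s := by omega
      obtain ⟨c1, c2, c3, c4, c5⟩ := hc
      unfold Cov del
      refine ⟨s - 1, e - 1, by omega, ?_, ?_, ?_, ?_⟩
      · rw [if_neg (by omega), if_neg (by omega), show e - 1 + 1 = e by omega]
        exact c2
      · intro x hx hxe
        rw [if_neg (by omega), if_neg (by omega), show e - 1 + 1 = e by omega]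
        have := c3 (x + 1) (by omega) (by omega)
        omega
      · right
        rw [if_neg (show ¬ (e - 1 ≤ d) by omega), show e - 1 + 1 = e by omega]
        split_ifs with h3
        · have : s = d + 1 := by omega
          subst this
          simp only [Nat.add_sub_cancel]
          omega
        · rw [show s - 1 + 1 = s by omega]
          omega
      · intro x
        have a1 := ha x
        have a2 := ha (x + 1)
        split_ifs <;> omega
  · have he : e < d := by
      rcases Nat.lt_or_ge e d with h' | h'
      · exact h'
      · have : e = d := by omega
        subst this
        have := hc.2.1
        omega
    obtain ⟨c1, c2, c3, c4, c5⟩ := hc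
    unfold Cov del
    refine ⟨s, e, c1, ?_, ?_, ?_, ?_⟩
    · rw [if_pos (by omega), if_pos (by omega)]
      exact c2
    · intro x hx hxe
      rw [if_pos (by omega), if_pos (by omega)]
      exact c3 x hx hxe
    · rw [if_pos (by omega), if_pos (by omega)]
      exact c4
    · intro x
      have a1 := ha x
      have a2 := ha (x + 1)
      split_ifs <;> omega

lemma del1_cov {mu lam : ℕ → ℕ} {s e d : ℕ} (hm : IsDiagram mu) (hl : IsDiagram lam)
    (hc : Cov mu lam s e) (hd : 1 ≤ d)
    (hp : lam d = mu d) (hp' : lam (d + 1) = mu (d + 1)) (hlt : lam d = lam (d + 1) + 1) :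
    ∃ s' e', Cov (del1 d mu) (del1 d lam) s' e' := by
  have ha := fun x => hc.app x
  have h0 := ha d
  have h0' := ha (d + 1)
  have hpos : ∀ x, 1 ≤ x → x ≤ d → 1 ≤ lam x ∧ 1 ≤ mu x := by
    intro x hx hxd
    have := diag_anti hm hx hxd
    have := diag_anti hl hx hxd
    omega
  obtain ⟨c1, c2, c3, c4, c5⟩ := hc
  rcases Nat.lt_or_ge e d with h | h
  · have q := hpos e (by omega) (by omega)
    refine ⟨s, e, c1, ?_, ?_, ?_, ?_⟩
    · unfold del1
      have := hpos (e + 1) (by omega) (by omega)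
      rw [if_pos (by omega), if_pos (by omega)]
      omega
    · intro x hx hxe
      unfold del1
      rw [if_pos (by omega), if_pos (by omega)]
      have := c3 x hx hxe
      have := hpos x (by omega) (by omega)
      omega
    · unfold del1
      rw [if_pos (by omega), if_pos (by omega)]
      by_cases hs : s = 0
      · exact Or.inl hs
      · have := hpos s (by omega) (by omega)
        omega
    · intro x
      have a1 := ha x
      have a2 := ha (x + 1)
      have := hpos x
      unfold del1
      split_ifs <;> omega
  · unfold Cov del1
    refine ⟨s - 1, e - 1, by omega, ?_, ?_, ?_, ?_⟩
    · rw [if_neg (by omega), if_neg (by omega), show e - 1 + 1 = e by omega]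
      exact c2
    · intro x hx hxe
      rw [if_neg (by omega), if_neg (by omega), show e - 1 + 1 = e by omega]
      have := c3 (x + 1) (by omega) (by omega)
      omega
    · right
      rw [if_neg (show ¬ (e - 1 ≤ d) by omega), show e - 1 + 1 = e by omega]
      split_ifs with h3
      · have : s = d + 1 := by omega
        subst this
        simp only [Nat.add_sub_cancel]
        omega
      · rw [show s - 1 + 1 = s by omega]
        omega
    · intro x
      have a1 := ha x
      have a2 := ha (x + 1)
      split_ifs <;> omega

/-! ### The map on chains -/

/-- `d` is the row index used in the definition of `Ĉ(r)`. -/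
structure DSpec (Y : ℕ → ℕ → ℕ) (n r d : ℕ) : Prop where
  one : 1 ≤ d
  eq : Y r d + d = n
  lt : ∀ k, 1 ≤ k → k < d → Y r k + k < n

lemma DSpec.unique {Y : ℕ → ℕ → ℕ} {n r d d' : ℕ} (h : DSpec Y n r d) (h' : DSpec Y n r d') :
    d = d' := by
  have h1 := h.lt d' h'.one
  have h2 := h'.lt d h.one
  have := h.eq
  have := h'.eq
  omega

lemma hatD_spec {Y : ℕ → ℕ → ℕ} {l n r : ℕ} (hY : Chn Y l n) (hn : 1 ≤ n) (hr : r ≤ l) :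
    DSpec Y n r (hatD (psiFun Y l) n r) := by
  have hlow : ∀ k, 1 ≤ k → k ≤ n - 1 →
      ((1 ≤ psiFun Y l (k, n - k) ∧ psiFun Y l (k, n - k) ≤ r) ↔ Y r k + k = n) := by
    intro k h1 h2
    have a := psi_le hY.step hY.zero (x := k) (y := n - k) h1 (by omega) hr
    have b := hY.le_stair hr h1
    omega
  have hm := Nat.sInf_mem (s := {k | 1 ≤ k ∧ k ≤ n - 1 ∧ 1 ≤ psiFun Y l (k, n - k) ∧
    psiFun Y l (k, n - k) ≤ r} ∪ {n}) ⟨n, Or.inr rfl⟩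
  have hmin : ∀ k, k < hatD (psiFun Y l) n r → k ∉ ({k | 1 ≤ k ∧ k ≤ n - 1 ∧
      1 ≤ psiFun Y l (k, n - k) ∧ psiFun Y l (k, n - k) ≤ r} ∪ {n} : Set ℕ) :=
    fun k hk => Nat.notMem_of_lt_sInf hk
  change hatD (psiFun Y l) n r ∈ _ at hm
  generalize hatD (psiFun Y l) n r = d at *
  have hdn : 1 ≤ d ∧ d ≤ n ∧ Y r d + d = n := by
    rcases hm with ⟨h1, h2, h3⟩ | h
    · have := (hlow d h1 h2).1 h3
      omega
    · have h : d = n := h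
      subst h
      have := hY.le_stair hr hn
      omega
  refine ⟨hdn.1, hdn.2.2, ?_⟩
  intro k hk hkd
  have := hY.le_stair hr hk
  by_contra hge
  exact hmin k hkd (Or.inl ⟨hk, by omega, (hlow k hk (by omega)).2 (by omega)⟩)

lemma Hp_down {Y : ℕ → ℕ → ℕ} {l r d : ℕ} (step : ∀ r, r < l → ∃ s e, Cov (Y r) (Y (r + 1)) s e)
    (hr : r ≤ l) (h : Hp (Y r) d) {j : ℕ} (hj : j ≤ r) : Hp (Y j) d := by
  induction r, hj using Nat.le_induction with
  | base => exact h
  | succ r hjr ih =>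
    obtain ⟨s, e, hc⟩ := step r (by omega)
    exact ih (by omega) (h.back hc)

lemma eq_down {Y : ℕ → ℕ → ℕ} {l n r d : ℕ} (hY : Chn Y l n) (hd : 1 ≤ d)
    (hr : r ≤ l) (h : Y r d = Y r (d + 1)) {j : ℕ} (hj : j ≤ r) : Y j d = Y j (d + 1) := by
  induction r, hj using Nat.le_induction with
  | base => exact h
  | succ r hjr ih =>
    obtain ⟨s, e, hc⟩ := hY.step r (by omega)
    exact ih (by omega) (back_eq (hY.diag r (by omega)) hc hd h)

lemma DSpec.hp {Y : ℕ → ℕ → ℕ} {n r d : ℕ} (h : DSpec Y n r d) : Hp (Y r) d := by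
  intro x hx hxd
  have := h.lt x hx hxd
  have := h.eq
  omega

lemma DSpec.const {Y : ℕ → ℕ → ℕ} {l n r d : ℕ} (h : DSpec Y n r d) (hY : Chn Y l n) {j : ℕ}
    (hj : j ≤ l) (hrj : r ≤ j) : Y j d + d = n := by
  have h1 := chn_mono hY.step hrj hj d
  have h2 := hY.le_stair hj h.one
  have := h.eq
  omega

lemma hatY_lo {Y : ℕ → ℕ → ℕ} {d r j : ℕ} (h : j ≤ r) : hatY Y d r j = ins d (Y j) := by
  simp [hatY, h]

lemma hatY_hi {Y : ℕ → ℕ → ℕ} {d r j : ℕ} (h : r ≤ j) : hatY Y d r (j + 1) = ins1 d (Y j) := by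
  unfold hatY
  rw [if_neg (by omega), Nat.add_sub_cancel]

lemma hat_step {Y : ℕ → ℕ → ℕ} {n r d : ℕ} (h : DSpec Y n r d) (h0 : Y r 0 = 0) :
    Cov (hatY Y d r r) (hatY Y d r (r + 1)) 0 d := by
  rw [hatY_lo le_rfl, hatY_hi le_rfl]
  have h1 := h.one
  have h2 := h.eq
  have h3 := h.lt
  unfold Cov ins ins1
  refine ⟨by omega, ?_, ?_, Or.inl rfl, ?_⟩
  · simp only [Nat.add_sub_cancel]
    rw [if_neg (by omega), if_neg (by omega), if_neg (by omega), if_pos le_rfl]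
    omega
  · intro x hx hxd
    rw [if_neg (show ¬ x = 0 by omega), if_pos (show x ≤ d by omega),
      if_neg (show ¬ d = 0 by omega), if_pos le_rfl]
    have := h3 x hx hxd
    omega
  · intro x
    by_cases hx0 : x = 0
    · subst hx0
      simp [h0]
    · split_ifs <;> omega

lemma hat_chn {Y : ℕ → ℕ → ℕ} {l n r d : ℕ} (h : DSpec Y n r d) (hY : Chn Y l n) (hr : r ≤ l) :
    Chn (hatY Y d r) (l + 1) (n + 1) := by
  refine ⟨?_, ?_, ?_, ?_⟩
  · intro j hj
    rcases Nat.lt_or_ge r j with hrj | hrj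
    · obtain ⟨j, rfl⟩ : ∃ k, j = k + 1 := ⟨j - 1, by omega⟩
      rw [hatY_hi (by omega)]
      exact ins1_diag (hY.diag j (by omega)) d h.one
    · rw [hatY_lo hrj]
      exact ins_diag (hY.diag j (by omega)) d h.one
  · intro x
    rw [hatY_lo (by omega)]
    simp [ins, hY.zero]
  · intro j hj
    rcases Nat.lt_trichotomy j r with hjr | rfl | hjr
    · obtain ⟨s, e, hc⟩ := hY.step j (by omega)
      rw [hatY_lo (by omega), hatY_lo (by omega)]
      exact ins_cov hc h.one (Hp_down hY.step hr h.hp (by omega))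
    · exact ⟨_, _, hat_step h (hY.diag j hr).1⟩
    · obtain ⟨j, rfl⟩ : ∃ k, j = k + 1 := ⟨j - 1, by omega⟩
      obtain ⟨s, e, hc⟩ := hY.step j (by omega)
      rw [hatY_hi (by omega), hatY_hi (by omega)]
      have a1 := h.const hY (j := j) (by omega) (by omega)
      have a2 := h.const hY (j := j + 1) (by omega) (by omega)
      exact ins1_cov hc h.one (by omega)
  · intro x
    rw [hatY_hi hr]
    have h1 := h.eq
    unfold ins1 dstair
    split_ifs
    · rfl
    · rw [hY.top' (by omega)]; omega
    · have := h.one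
      rw [hY.top' (by omega)]; omega

lemma hat_fun {Y : ℕ → ℕ → ℕ} {l n r d : ℕ} (h : DSpec Y n r d) (hY : Chn Y l n) (hr : r ≤ l)
    (hn : 1 ≤ n) : hatFun (psiFun Y l) n r = psiFun (hatY Y d r) (l + 1) := by
  have hd : hatD (psiFun Y l) n r = d := (hatD_spec hY hn hr).unique h
  have hZ := hat_chn h hY hr
  have h1 := h.one
  have hdr := h.eq
  apply psi_unique hZ.step hZ.zero
  · intro x y hxy
    rw [hZ.top] at hxy
    unfold dstair at hxy
    unfold hatFun
    simp only [hd]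
    by_cases hxy0 : x = 0 ∨ y = 0
    · rw [if_pos hxy0]
    rw [if_neg hxy0]
    rw [if_neg (show ¬ x = 0 by omega)] at hxy
    have hz : ∀ x y, 1 ≤ x → n - x < y → psiFun Y l (x, y) = 0 := by
      intro x y hx hy
      apply (psi_zero hY.zero).2
      rw [hY.top' hx]
      omega
    by_cases hxd : x ≤ d
    · rw [if_pos hxd, psi_lowLen hY.step hY.zero (by omega) hr]
      have b := hY.le_stair hr (show 1 ≤ x by omega)
      rw [hz x y (by omega) (by omega)]
      rw [if_neg (by omega), if_neg (by omega), hz x (y - 1) (by omega) (by omega),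
        if_neg (by omega)]
    · rw [if_neg hxd]
      split_ifs with h2 h3 h4
      · exact hz d y h1 (by omega)
      · rfl
      · exact absurd (hz (x - 1) y (by omega) (by omega)) h3
      · exact absurd (hz (x - 1) y (by omega) (by omega)) h3
  · intro x y j hx hy hj ha hb
    unfold hatFun
    simp only [hd]
    rw [if_neg (by omega)]
    have E : ∀ x y j, 1 ≤ x → 1 ≤ y → j < l → Y j x < y → y ≤ Y (j + 1) x →
        psiFun Y l (x, y) = j + 1 := by
      intro x y j h1 h2 h3 h4 h5
      exact (psi_eq hY.step hY.zero).2 ⟨h1, h2, h3, h4, h5⟩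
    have P : ∀ x y, 1 ≤ x → 1 ≤ y →
        ((psiFun Y l (x, y) ≠ 0 ∧ psiFun Y l (x, y) ≤ r) ↔ y ≤ Y r x) :=
      fun x y hx hy => psi_le hY.step hY.zero hx hy hr
    rcases Nat.lt_trichotomy j r with hjr | rfl | hjr
    · rw [hatY_lo (by omega)] at ha hb
      unfold ins at ha hb
      have m1 := chn_mono hY.step (show j + 1 ≤ r by omega) hr
      by_cases hxd : x ≤ d
      · rw [if_pos hxd] at ha hb ⊢
        have := E x y j hx hy (by omega) ha hb
        rw [this, if_pos (by omega)]
      · rw [if_neg hxd] at ha hb ⊢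
        have := E (x - 1) y j (by omega) hy (by omega) ha hb
        split_ifs with h2
        · subst h2
          simpa using this
        · omega
        · exact this
        · omega
    · rw [hatY_lo (by omega)] at ha
      rw [hatY_hi (by omega)] at hb
      unfold ins at ha
      unfold ins1 at hb
      rw [if_neg (by omega)] at hb
      by_cases hxd : x ≤ d
      · rw [if_pos hxd] at ha hb ⊢
        have := P x y hx hy
        rw [if_neg (by omega), psi_lowLen hY.step hY.zero (by omega) hr, if_pos (by omega)]
      · rw [if_neg hxd] at ha hb
        omega
    · obtain ⟨j, rfl⟩ : ∃ k, j = k + 1 := ⟨j - 1, by omega⟩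
      rw [hatY_hi (by omega)] at ha hb
      unfold ins1 at ha hb
      rw [if_neg (by omega)] at ha hb
      have m1 := chn_mono hY.step (show r ≤ j by omega) (by omega)
      by_cases hxd : x ≤ d
      · rw [if_pos hxd] at ha hb ⊢
        have := P x y hx hy
        have := m1 x
        rw [if_neg (by omega), psi_lowLen hY.step hY.zero (by omega) hr, if_neg (by omega)]
        have := E x (y - 1) j hx (by omega) (by omega) (by omega) (by omega)
        rw [this, if_pos (by omega)]
      · rw [if_neg hxd] at ha hb ⊢
        have := E (x - 1) y j (by omega) hy (by omega) ha hb
        split_ifs with h2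
        · subst h2
          have a1 := h.const hY (j := j) (by omega) (by omega)
          have a2 := h.const hY (j := j + 1) (by omega) (by omega)
          simp only [Nat.add_sub_cancel] at ha hb
          omega
        · omega
        · omega
        · omega

lemma hat_PF {Y : ℕ → ℕ → ℕ} {l n r d : ℕ} (h : DSpec Y n r d) (hY : Chn Y l n) (hr : r ≤ l)
    {j : ℕ} (hj : j < r) : PF Y n j ↔ PF (hatY Y d r) (n + 1) j := by
  have h1 := h.one
  have hp := Hp_down hY.step hr h.hp (show j + 1 ≤ r by omega)
  have m1 := chn_mono hY.step (show j + 1 ≤ r by omega) hr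
  unfold PF
  rw [hatY_lo (by omega), hatY_lo (by omega)]
  constructor
  · rintro ⟨k, hc, hk, ha, hb⟩
    have hkd : d ≤ k := by
      by_contra hlt
      have := h.lt k hc.1 (by omega)
      have := m1 k
      omega
    refine ⟨k + 1, ins_cov_hi0 hc h1 hkd, by omega, ?_, ?_⟩
    · unfold ins
      rw [if_neg (by omega), Nat.add_sub_cancel]
      omega
    · unfold ins
      rw [if_neg (by omega), Nat.add_sub_cancel]
      omega
  · rintro ⟨k, hc, hk, ha, hb⟩
    have hdi : ∀ lam : ℕ → ℕ, del d (ins d lam) = lam := by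
      intro lam
      funext x
      unfold del ins
      split_ifs
      · rfl
      · omega
      · rw [Nat.add_sub_cancel]
    have hkd : d + 1 ≤ k := by
      by_contra hlt
      unfold ins at ha
      rw [if_pos (by omega)] at ha
      have := hY.le_stair (j := j + 1) (by omega) (show 1 ≤ k from hc.1)
      have := hc.1
      omega
    have hp' : Hp (ins d (Y (j + 1))) d := by
      intro x hx hxd
      unfold ins
      rw [if_pos (by omega), if_pos le_rfl]
      exact hp x hx hxd
    have := del_cov_hi0 hc h1 hkd hp' (by simp [ins])
    rw [hdi, hdi] at this
    unfold ins at ha hb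
    rw [if_neg (by omega)] at ha hb
    rw [Nat.add_sub_cancel] at hb
    refine ⟨k - 1, this, by omega, by omega, ?_⟩
    rw [show k - 1 + 1 = k by omega]
    omega

lemma hat_plus {Y : ℕ → ℕ → ℕ} {l n r d : ℕ} (h : DSpec Y n r d) (hY : Chn Y l n) (hr : r ≤ l)
    {j : ℕ} (hj : j < r) : HasPlusFullSet (psiFun Y l) n (j + 1) ↔
      HasPlusFullSet (psiFun (hatY Y d r) (l + 1)) (n + 1) (j + 1) := by
  rw [plus_iff hY (by omega), plus_iff (hat_chn h hY hr) (by omega), hat_PF h hY hr hj]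

lemma hat_PF_self {Y : ℕ → ℕ → ℕ} {l n r d : ℕ} (h : DSpec Y n r d) (hY : Chn Y l n) (hr : r ≤ l)
    : PF (hatY Y d r) (n + 1) r := by
  have h1 := h.one
  have h2 := h.eq
  refine ⟨d, hat_step h (hY.diag r hr).1, by omega, ?_, ?_⟩
  · rw [hatY_hi le_rfl]
    unfold ins1
    rw [if_neg (by omega), if_pos le_rfl]
    omega
  · rw [hatY_hi le_rfl]
    unfold ins1
    rw [if_neg (by omega), if_neg (by omega), Nat.add_sub_cancel]
    omega

/-! ### The inverse -/

lemma unhat {Z : ℕ → ℕ → ℕ} {l n r : ℕ} (hZ : Chn Z (l + 1) (n + 1)) (hr : r ≤ l)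
    (hpf : PF Z (n + 1) r) : ∃ Y d, Chn Y l n ∧ DSpec Y n r d ∧
      ∀ j, j ≤ l + 1 → ∀ x, hatY Y d r j x = Z j x := by
  obtain ⟨d, hc, hdn, ha, hb⟩ := hpf
  have hd : 1 ≤ d := hc.1
  have a1 := hc.app d
  have a2 := hc.app (d + 1)
  have happ := fun x => hc.app x
  have hp1 : Hp (Z (r + 1)) d := fun x hx hxd => hc.2.2.1 x hx hxd
  have hp : ∀ j, j ≤ r → Hp (Z j) d := fun j hj =>
    Hp_down hZ.step (show r + 1 ≤ l + 1 by omega) hp1 (by omega)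
  have heq : ∀ j, j ≤ r → Z j d = Z j (d + 1) := fun j hj =>
    eq_down hZ hd (show r ≤ l + 1 by omega) (by omega) hj
  have hcd : ∀ j, r + 1 ≤ j → j ≤ l + 1 → Z j d + d = n + 1 ∧ Z j (d + 1) + d = n := by
    intro j h1 h2
    have m1 := chn_mono hZ.step h1 h2 d
    have m2 := chn_mono hZ.step h1 h2 (d + 1)
    have m3 := hZ.le_stair h2 hd
    have m4 := hZ.le_stair h2 (show 1 ≤ d + 1 by omega)
    omega
  have hpos : ∀ j, r + 1 ≤ j → j ≤ l + 1 → ∀ x, 1 ≤ x → x ≤ d → 1 ≤ Z j x := by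
    intro j h1 h2 x hx hxd
    have := diag_anti (hZ.diag j h2) hx hxd
    have := hcd j h1 h2
    omega
  have hlo : ∀ j, j ≤ r → unY Z d r j = del d (Z j) := by
    intro j hj
    simp [unY, hj]
  have hhi : ∀ j, r ≤ j → unY Z d r j = del1 d (Z (j + 1)) := by
    intro j hj
    rcases Nat.lt_or_ge r j with h | h
    · unfold unY
      rw [if_neg (by omega)]
    · have : j = r := by omega
      subst this
      rw [hlo j le_rfl]
      funext x
      have q := happ x
      have q' := happ (x + 1)
      have z1 := (hZ.diag j (by omega)).1
      unfold del del1
      by_cases hx : x = 0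
      · subst hx
        simp only [Nat.zero_le, if_true]
        omega
      · split_ifs <;> omega
  refine ⟨unY Z d r, d, ⟨?_, ?_, ?_, ?_⟩, ⟨hd, ?_, ?_⟩, ?_⟩
  · intro j hj
    rcases Nat.lt_or_ge r j with h | h
    · rw [hhi j (by omega)]
      have := hcd (j + 1) (by omega) (by omega)
      exact del1_diag (hZ.diag _ (by omega)) d (by omega)
    · rw [hlo j h]
      exact del_diag (hZ.diag _ (by omega)) d
  · intro x
    rw [hlo 0 (by omega)]
    simp [del, hZ.zero]
  · intro j hj
    rcases Nat.lt_or_ge j r with h | h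
    · rw [hlo j (by omega), hlo (j + 1) (by omega)]
      obtain ⟨s, e, hc'⟩ := hZ.step j (by omega)
      exact del_cov (hZ.diag j (by omega)) hc' hd (hp _ (by omega)) (heq _ (by omega))
    · rw [hhi j (by omega), hhi (j + 1) (by omega)]
      obtain ⟨s, e, hc'⟩ := hZ.step (j + 1) (by omega)
      have q1 := hcd (j + 1) (by omega) (by omega)
      have q2 := hcd (j + 1 + 1) (by omega) (by omega)
      exact del1_cov (hZ.diag _ (by omega)) (hZ.diag _ (by omega)) hc' hd (by omega) (by omega)
        (by omega)
  · intro x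
    rw [hhi l hr]
    unfold del1 dstair
    by_cases hx : x = 0
    · subst hx
      have := (hZ.diag (l + 1) le_rfl).1
      simp [this]
    · rw [hZ.top' (by omega), hZ.top' (by omega)]
      split_ifs <;> omega
  · rw [hlo r le_rfl]
    unfold del
    rw [if_pos le_rfl]
    omega
  · intro k hk hkd
    rw [hlo r le_rfl]
    unfold del
    rw [if_pos (by omega)]
    have := hp r le_rfl k hk hkd
    omega
  · intro j hj x
    rcases Nat.lt_or_ge r j with h | h
    · obtain ⟨j, rfl⟩ : ∃ k, j = k + 1 := ⟨j - 1, by omega⟩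
      rw [hatY_hi (by omega), hhi j (by omega)]
      unfold ins1 del1
      have q := hcd (j + 1) (by omega) (by omega)
      split_ifs with h1 h2 h3
      · rw [h1, (hZ.diag (j + 1) hj).1]
      · have := hpos (j + 1) (by omega) hj x (by omega) h2
        omega
      · have : x = d + 1 := by omega
        subst this
        rw [Nat.add_sub_cancel]
        omega
      · rw [show x - 1 + 1 = x by omega]
    · rw [hatY_lo h, hlo j h]
      unfold ins del
      split_ifs
      · rfl
      · have : x = d + 1 := by omega
        subst this
        rw [Nat.add_sub_cancel]
        exact heq j h
      · rw [show x - 1 + 1 = x by omega]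

/-- **Theorem 4.8.**  For `i ≥ -1`, `n ≥ 1` and `0 ≤ r ≤ n + i`, the map
`φ_{i,n}^r : C ↦ Ĉ(r)` is a bijection from
`{C ∈ C_i(n) : for all j ∈ [r], the j-set of C is not a plus-full-set}` to `F_i^{r+1}(n+1)`. -/
theorem phi_bijection (i : ℤ) (hi : -1 ≤ i) (n : ℕ) (hn : 1 ≤ n) (r : ℕ)
    (hr : (r : ℤ) ≤ (n : ℤ) + i) :
    Set.BijOn (fun C => hatFun C n r)
      {C : ℕ × ℕ → ℕ | MemC i n C ∧ ∀ j, 1 ≤ j → j ≤ r → ¬ HasPlusFullSet C n j}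
      {C : ℕ × ℕ → ℕ | MemF i (n + 1) (r + 1) C} := by
  refine ⟨?_, ?_, ?_⟩
  · rintro C ⟨hC, hno⟩
    obtain ⟨Y, l, hY, hl, rfl⟩ := memC_iff.1 hC
    have hrl : r ≤ l := by omega
    have hD := hatD_spec hY hn hrl
    have hZ := hat_chn hD hY hrl
    change MemF i (n + 1) (r + 1) (hatFun (psiFun Y l) n r)
    rw [hat_fun hD hY hrl hn]
    refine ⟨memC_iff.2 ⟨_, _, hZ, by push_cast; omega, rfl⟩, ?_, ?_⟩
    · exact (plus_iff hZ (by omega)).2 (hat_PF_self hD hY hrl)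
    · intro j hj1 hj2
      obtain ⟨j, rfl⟩ : ∃ k, j = k + 1 := ⟨j - 1, by omega⟩
      rw [← hat_plus hD hY hrl (by omega)]
      exact hno (j + 1) (by omega) (by omega)
  · rintro C ⟨hC, -⟩ C' ⟨hC', -⟩ heq
    obtain ⟨Y, l, hY, hl, rfl⟩ := memC_iff.1 hC
    obtain ⟨Y', l', hY', hl', rfl⟩ := memC_iff.1 hC'
    have hll : l' = l := by omega
    subst hll
    have hrl : r ≤ l' := by omega
    have hD := hatD_spec hY hn hrl
    have hD' := hatD_spec hY' hn hrl
    generalize hatD (psiFun Y l') n r = d at *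
    generalize hatD (psiFun Y' l') n r = d' at *
    change hatFun (psiFun Y l') n r = hatFun (psiFun Y' l') n r at heq
    rw [hat_fun hD hY hrl hn, hat_fun hD' hY' hrl hn] at heq
    have hZ := hat_chn hD hY hrl
    have hZ' := hat_chn hD' hY' hrl
    have key : ∀ j, j ≤ l' + 1 → ∀ x, hatY Y d r j x = hatY Y' d' r j x :=
      fun j hj x => psi_inj hZ hZ' heq hj x
    have hdd : d = d' := by
      have k1 := key r (by omega)
      have k2 := key (r + 1) (by omega)
      have o1 := hD.one
      have o2 := hD'.one
      have s1 := hat_step hD (hY.diag r hrl).1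
      have s2 := hat_step hD' (hY'.diag r hrl).1
      have b1 := s1.app d
      have b2 := s2.app d
      have b3 := s1.app d'
      have b4 := s2.app d'
      have := k1 d
      have := k1 d'
      have := k2 d
      have := k2 d'
      omega
    subst hdd
    apply psi_congr
    intro j hj x
    rcases Nat.eq_zero_or_pos x with rfl | hx
    · rw [(hY.diag j hj).1, (hY'.diag j hj).1]
    rcases Nat.lt_or_ge r j with h | h
    · have k := key (j + 1) (by omega)
      rw [hatY_hi (by omega), hatY_hi (by omega)] at k
      unfold ins1 at k
      by_cases hxd : x ≤ d
      · have := k x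
        rw [if_neg (by omega), if_pos hxd, if_neg (by omega), if_pos hxd] at this
        omega
      · have := k (x + 1)
        rw [if_neg (by omega), if_neg (by omega), if_neg (by omega), if_neg (by omega),
          Nat.add_sub_cancel] at this
        exact this
    · have k := key j (by omega)
      rw [hatY_lo (by omega), hatY_lo (by omega)] at k
      unfold ins at k
      by_cases hxd : x ≤ d
      · have := k x
        rw [if_pos hxd, if_pos hxd] at this
        exact this
      · have := k (x + 1)
        rw [if_neg (by omega), if_neg (by omega), Nat.add_sub_cancel] at this
        exact this
  · rintro F ⟨hF, hplus, hno⟩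
    obtain ⟨Z, L, hZ, hL, rfl⟩ := memC_iff.1 hF
    obtain ⟨l, rfl⟩ : ∃ l, L = l + 1 := ⟨L - 1, by push_cast at hL; omega⟩
    push_cast at hL
    have hrl : r ≤ l := by omega
    obtain ⟨Y, d, hY, hD, hYZ⟩ := unhat hZ hrl ((plus_iff hZ (by omega)).1 hplus)
    have hpsi := psi_congr hYZ
    refine ⟨psiFun Y l, ⟨memC_iff.2 ⟨Y, l, hY, by omega, rfl⟩, ?_⟩, ?_⟩
    · intro j hj1 hj2
      obtain ⟨j, rfl⟩ : ∃ k, j = k + 1 := ⟨j - 1, by omega⟩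
      rw [hat_plus hD hY hrl (by omega), hpsi]
      exact hno (j + 1) (by omega) (by omega)
    · change hatFun (psiFun Y l) n r = _
      rw [hat_fun hD hY hrl hn, hpsi]

end TamariMaxChains
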